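/- In the pooled day-to-day model, define G_T(φ, X_{1:T}) = (1/T) Σ_{t=1}^T D_t(φ, X_t), where D_t(φ, X_t) = Z_t(φ, X_t) − E[Z_t(φ, X_t) | F_{t-1}] and Z_t(φ, X_t) = log s_t(φ, X_t) − log s_t(φ_0, X_t). Then there exists a constant L, depending only on the cost bound C, θ_max and η_min, such that for all φ, φ' ∈ Θ, all T, and every realization of X_{1:T}, |G_T(φ, X_{1:T}) − G_T(φ', X_{1:T})| ≤ L ‖φ − φ'‖; in particular one may take L = 2 √((2C)² + (4C θ_max / η_min)²). -/

import Mathlib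

/-!
STATEMENT 6: Uniform Lipschitz continuity of G_T(φ, X_{1:T}) = (1/T) Σ_{t=1}^T D_t(φ, X_t)
in φ over the compact parameter space Θ: there is a constant L, depending only on the cost
bound C, θ_max and η_min, with |G_T(φ) − G_T(φ')| ≤ L ‖φ − φ'‖ (Euclidean norm) for all
φ, φ' ∈ Θ, all T, and every realization of X_{1:T}; one may take
L = 2 √((2C)² + (4C θ_max / η_min)²).
-/

noncomputable section

/-- Perceived costs starting from `V 0 = 0`. -/
def percVal (M : ℕ) (c : ℕ → Fin M → ℝ) (η : ℝ) : ℕ → Fin M → ℝ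
  | 0 => fun _ => 0
  | t + 1 => fun i => (1 - η) * percVal M c η t i + η * c t i

/-- Day-`t` choice probability of path `i` under parameter `φ = (η, θ)`. -/
def sProb (M : ℕ) (c : ℕ → Fin M → ℝ) (φ : ℝ × ℝ) (t : ℕ) (i : Fin M) : ℝ :=
  Real.exp (-φ.2 * percVal M c φ.1 t i) /
    ∑ m : Fin M, Real.exp (-φ.2 * percVal M c φ.1 t m)

/-- Log-likelihood ratio `Z_t(φ, x)` relative to the true parameter `φ0`. -/
def Zterm (M : ℕ) (c : ℕ → Fin M → ℝ) (φ0 φ : ℝ × ℝ) (t : ℕ) (x : Fin M) : ℝ :=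
  Real.log (sProb M c φ t x) - Real.log (sProb M c φ0 t x)

/-- `D_t(φ, x) = Z_t(φ, x) − E[Z_t(φ, X_t) | F_{t-1}]` (the conditional expectation is
the deterministic average of `Z_t(φ, ·)` under `s_t(φ0, ·)`). -/
def Dterm (M : ℕ) (c : ℕ → Fin M → ℝ) (φ0 φ : ℝ × ℝ) (t : ℕ) (x : Fin M) : ℝ :=
  Zterm M c φ0 φ t x - ∑ m : Fin M, sProb M c φ0 t m * Zterm M c φ0 φ t m

/-- `G_T(φ, x_{1:T}) = (1/T) Σ_{t=1}^T D_t(φ, x_t)`. -/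
def GT (M : ℕ) (c : ℕ → Fin M → ℝ) (φ0 φ : ℝ × ℝ) (T : ℕ) (x : ℕ → Fin M) : ℝ :=
  (1 / (T : ℝ)) * ∑ t ∈ Finset.range T, Dterm M c φ0 φ t (x t)

/-- Log-sum-exp is `1`-Lipschitz for the sup distance (one-sided form). -/
lemma log_sum_exp_le_add {ι : Type*} [Fintype ι] [Nonempty ι] {a b : ι → ℝ} {δ : ℝ}
    (h : ∀ i, a i ≤ b i + δ) :
    Real.log (∑ i, Real.exp (a i)) ≤ Real.log (∑ i, Real.exp (b i)) + δ := by
  have hpos : ∀ f : ι → ℝ, 0 < ∑ i, Real.exp (f i) := fun f =>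
    Finset.sum_pos (fun i _ => Real.exp_pos _) Finset.univ_nonempty
  rw [← Real.log_exp δ, ← Real.log_mul (hpos b).ne' (Real.exp_pos δ).ne']
  refine Real.log_le_log (hpos a) ?_
  rw [Finset.sum_mul]
  refine Finset.sum_le_sum fun i _ => ?_
  rw [← Real.exp_add]
  exact Real.exp_le_exp.mpr (h i)

lemma log_sProb (M : ℕ) [NeZero M] (c : ℕ → Fin M → ℝ) (φ : ℝ × ℝ) (t : ℕ) (i : Fin M) :
    Real.log (sProb M c φ t i) = -φ.2 * percVal M c φ.1 t i -
      Real.log (∑ m : Fin M, Real.exp (-φ.2 * percVal M c φ.1 t m)) := by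
  have hpos : 0 < ∑ m : Fin M, Real.exp (-φ.2 * percVal M c φ.1 t m) :=
    Finset.sum_pos (fun i _ => Real.exp_pos _) Finset.univ_nonempty
  rw [sProb, Real.log_div (Real.exp_pos _).ne' hpos.ne', Real.log_exp]

lemma sProb_nonneg (M : ℕ) (c : ℕ → Fin M → ℝ) (φ : ℝ × ℝ) (t : ℕ) (i : Fin M) :
    0 ≤ sProb M c φ t i := by
  unfold sProb
  positivity

lemma sum_sProb (M : ℕ) [NeZero M] (c : ℕ → Fin M → ℝ) (φ : ℝ × ℝ) (t : ℕ) :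
    ∑ i, sProb M c φ t i = 1 := by
  have hpos : 0 < ∑ m : Fin M, Real.exp (-φ.2 * percVal M c φ.1 t m) :=
    Finset.sum_pos (fun i _ => Real.exp_pos _) Finset.univ_nonempty
  simp only [sProb]
  rw [← Finset.sum_div, div_self hpos.ne']

lemma abs_percVal_le {M : ℕ} {c : ℕ → Fin M → ℝ} {C η : ℝ} (hc : ∀ t i, |c t i| ≤ C)
    (hη0 : 0 ≤ η) (hη1 : η ≤ 1) (t : ℕ) (i : Fin M) : |percVal M c η t i| ≤ C := by
  induction t with
  | zero => simpa [percVal] using (abs_nonneg _).trans (hc 0 i)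
  | succ t ih =>
    have h := hc t i
    rw [abs_le] at h ih ⊢
    simp only [percVal]
    constructor <;> nlinarith

/-- Perceived costs are Lipschitz in the learning rate, uniformly in time. -/
lemma abs_percVal_sub_le {M : ℕ} {c : ℕ → Fin M → ℝ} {C η η' ηmin : ℝ}
    (hc : ∀ t i, |c t i| ≤ C) (hmin : 0 < ηmin) (hη : ηmin ≤ η) (hη1 : η ≤ 1)
    (hη' : ηmin ≤ η') (hη'1 : η' ≤ 1) (t : ℕ) (i : Fin M) :
    |percVal M c η t i - percVal M c η' t i| ≤ 2 * C / ηmin * |η - η'| := by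
  have hC : 0 ≤ C := (abs_nonneg _).trans (hc 0 i)
  induction t with
  | zero =>
    simp only [percVal, sub_self, abs_zero]
    positivity
  | succ t ih =>
    have hrec : percVal M c η (t + 1) i - percVal M c η' (t + 1) i =
        (1 - η) * (percVal M c η t i - percVal M c η' t i) +
          (η - η') * (c t i - percVal M c η' t i) := by
      simp only [percVal]
      ring
    have hV := abs_percVal_le hc (hmin.le.trans hη') hη'1 t i
    have hd : |c t i - percVal M c η' t i| ≤ 2 * C :=
      (abs_sub _ _).trans (by linarith [hc t i])
    set K := 2 * C / ηmin * |η - η'| with hK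
    have hK0 : 0 ≤ K := by positivity
    have hKη : 2 * C * |η - η'| = ηmin * K := by
      rw [hK]
      field_simp
    calc _ ≤ (1 - η) * |percVal M c η t i - percVal M c η' t i| +
          |η - η'| * |c t i - percVal M c η' t i| := by
          rw [hrec]
          refine (abs_add_le _ _).trans_eq ?_
          rw [abs_mul, abs_mul, abs_of_nonneg (sub_nonneg.mpr hη1)]
      _ ≤ (1 - ηmin) * K + |η - η'| * (2 * C) := by
          gcongr
          linarith
      _ = K := by linarith

/-- If the systematic utilities at two parameters are `δ`-close, the log-likelihood ratios
are `2δ`-close. -/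
lemma abs_Zterm_sub_le {M : ℕ} [NeZero M] {c : ℕ → Fin M → ℝ} (φ0 : ℝ × ℝ) {φ φ' : ℝ × ℝ}
    {t : ℕ} {δ : ℝ}
    (h : ∀ i, |φ.2 * percVal M c φ.1 t i - φ'.2 * percVal M c φ'.1 t i| ≤ δ) (x : Fin M) :
    |Zterm M c φ0 φ t x - Zterm M c φ0 φ' t x| ≤ 2 * δ := by
  have h₁ := log_sum_exp_le_add (a := fun i => -φ.2 * percVal M c φ.1 t i)
    (b := fun i => -φ'.2 * percVal M c φ'.1 t i) (δ := δ)
    fun i => by linarith [(abs_le.mp (h i)).1]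
  have h₂ := log_sum_exp_le_add (a := fun i => -φ'.2 * percVal M c φ'.1 t i)
    (b := fun i => -φ.2 * percVal M c φ.1 t i) (δ := δ)
    fun i => by linarith [(abs_le.mp (h i)).2]
  have hx := abs_le.mp (h x)
  simp only [Zterm, log_sProb]
  rw [abs_le]
  constructor <;> linarith [hx.1, hx.2]

lemma abs_Dterm_sub_le {M : ℕ} [NeZero M] {c : ℕ → Fin M → ℝ} {φ0 φ φ' : ℝ × ℝ}
    {t : ℕ} {B : ℝ} (h : ∀ i, |Zterm M c φ0 φ t i - Zterm M c φ0 φ' t i| ≤ B) (x : Fin M) :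
    |Dterm M c φ0 φ t x - Dterm M c φ0 φ' t x| ≤ 2 * B := by
  have hsum : |∑ m, sProb M c φ0 t m * (Zterm M c φ0 φ t m - Zterm M c φ0 φ' t m)| ≤ B :=
    calc _ ≤ ∑ m, |sProb M c φ0 t m * (Zterm M c φ0 φ t m - Zterm M c φ0 φ' t m)| :=
          Finset.abs_sum_le_sum_abs _ _
      _ ≤ ∑ m, sProb M c φ0 t m * B := by
          refine Finset.sum_le_sum fun m _ => ?_
          rw [abs_mul, abs_of_nonneg (sProb_nonneg M c φ0 t m)]
          exact mul_le_mul_of_nonneg_left (h m) (sProb_nonneg M c φ0 t m)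
      _ = B := by rw [← Finset.sum_mul, sum_sProb, one_mul]
  have hD : Dterm M c φ0 φ t x - Dterm M c φ0 φ' t x =
      (Zterm M c φ0 φ t x - Zterm M c φ0 φ' t x) -
        ∑ m, sProb M c φ0 t m * (Zterm M c φ0 φ t m - Zterm M c φ0 φ' t m) := by
    simp only [Dterm, mul_sub, Finset.sum_sub_distrib]
    ring
  rw [hD]
  exact (abs_sub _ _).trans (by linarith [h x])

lemma abs_GT_sub_le {M : ℕ} {c : ℕ → Fin M → ℝ} {φ0 φ φ' : ℝ × ℝ} {B : ℝ} (hB : 0 ≤ B)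
    (h : ∀ t i, |Dterm M c φ0 φ t i - Dterm M c φ0 φ' t i| ≤ B) (T : ℕ) (x : ℕ → Fin M) :
    |GT M c φ0 φ T x - GT M c φ0 φ' T x| ≤ B := by
  rw [GT, GT, ← mul_sub, ← Finset.sum_sub_distrib, abs_mul, abs_of_nonneg (by positivity),
    one_div_mul_eq_div]
  refine div_le_of_le_mul₀ (by positivity) hB ?_
  calc _ ≤ ∑ t ∈ Finset.range T, |Dterm M c φ0 φ t (x t) - Dterm M c φ0 φ' t (x t)| :=
        Finset.abs_sum_le_sum_abs _ _
    _ ≤ ∑ _t ∈ Finset.range T, B := Finset.sum_le_sum fun t _ => h t (x t)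
    _ = B * T := by simp [mul_comm]

/-- Cauchy–Schwarz in the plane. -/
lemma mul_add_mul_le_sqrt_mul_sqrt (a b p q : ℝ) :
    a * p + b * q ≤ √(a ^ 2 + b ^ 2) * √(q ^ 2 + p ^ 2) := by
  rw [← Real.sqrt_mul (by positivity)]
  refine Real.le_sqrt_of_sq_le ?_
  nlinarith [sq_nonneg (a * q - b * p)]

theorem GT_uniformly_lipschitz
    (M : ℕ) (hM : 0 < M) (c : ℕ → Fin M → ℝ) (C : ℝ) (hc : ∀ t i, |c t i| ≤ C)
    (ηmin ηmax θmin θmax : ℝ)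
    (hη1 : 0 < ηmin) (hη2 : ηmin ≤ ηmax) (hη3 : ηmax < 1)
    (hθ1 : 0 < θmin) (hθ2 : θmin ≤ θmax)
    (φ0 : ℝ × ℝ) (hφ0 : φ0 ∈ Set.Icc ηmin ηmax ×ˢ Set.Icc θmin θmax) :
    ∃ L : ℝ, L = 2 * Real.sqrt ((2 * C) ^ 2 + (4 * C * θmax / ηmin) ^ 2) ∧
      ∀ φ ∈ Set.Icc ηmin ηmax ×ˢ Set.Icc θmin θmax,
      ∀ φ' ∈ Set.Icc ηmin ηmax ×ˢ Set.Icc θmin θmax,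
      ∀ (T : ℕ) (x : ℕ → Fin M),
        |GT M c φ0 φ T x - GT M c φ0 φ' T x|
          ≤ L * Real.sqrt ((φ.1 - φ'.1) ^ 2 + (φ.2 - φ'.2) ^ 2) := by
  refine ⟨_, rfl, ?_⟩
  rintro φ ⟨⟨hη, hηu⟩, hθ, hθu⟩ φ' ⟨⟨hη', hηu'⟩, hθ', hθu'⟩ T x
  have : NeZero M := ⟨hM.ne'⟩
  have hC : 0 ≤ C := (abs_nonneg _).trans (hc 0 (x 0))
  have hθmax : 0 ≤ θmax := hθ1.le.trans hθ2
  have hutil : ∀ t i, |φ.2 * percVal M c φ.1 t i - φ'.2 * percVal M c φ'.1 t i| ≤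
      C * |φ.2 - φ'.2| + 2 * C * θmax / ηmin * |φ.1 - φ'.1| := fun t i => by
    have hV := abs_percVal_sub_le hc hη1 hη (by linarith) hη' (by linarith) t i
    have hV' := abs_percVal_le hc (hη1.le.trans hη') (by linarith) t i
    calc _ = |φ.2 * (percVal M c φ.1 t i - percVal M c φ'.1 t i) +
          (φ.2 - φ'.2) * percVal M c φ'.1 t i| := by
          congr 1
          ring
      _ ≤ φ.2 * |percVal M c φ.1 t i - percVal M c φ'.1 t i| +
          |φ.2 - φ'.2| * |percVal M c φ'.1 t i| := by
          refine (abs_add_le _ _).trans_eq ?_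
          rw [abs_mul, abs_mul, abs_of_nonneg (hθ1.le.trans hθ)]
      _ ≤ θmax * (2 * C / ηmin * |φ.1 - φ'.1|) + |φ.2 - φ'.2| * C := by gcongr
      _ = _ := by ring
  have hG := abs_GT_sub_le (by positivity)
    (fun t => abs_Dterm_sub_le (abs_Zterm_sub_le φ0 (hutil t))) T x
  have hCS := mul_add_mul_le_sqrt_mul_sqrt (2 * C) (4 * C * θmax / ηmin)
    |φ.2 - φ'.2| |φ.1 - φ'.1|
  rw [sq_abs, sq_abs] at hCS
  calc _ ≤ _ := hG
    _ = 2 * (2 * C * |φ.2 - φ'.2| + 4 * C * θmax / ηmin * |φ.1 - φ'.1|) := by ring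
    _ ≤ _ := by linarith
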